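/- arXiv:2509.00522 — 4 statements merged into one kernel-verified Lean document; each statement's English description precedes it below -/
import Mathlib

section
/- Let S be a measurable subset of ℝ² with the Lebesgue measure, and let a₁, a₂ : S → ℝ³ be measurable maps such that for almost every ξ ∈ S the vectors a₁(ξ), a₂(ξ) are linearly independent and satisfy the angle condition min(‖a₁(ξ)‖, ‖a₂(ξ)‖)/max(‖a₁(ξ)‖, ‖a₂(ξ)‖) > ⟨a₁(ξ), a₂(ξ)⟩/(‖a₁(ξ)‖ ‖a₂(ξ)‖). For α, β ∈ {1,2} set a_{αβ}(ξ) = ⟨a_α(ξ), a_β(ξ)⟩, let a(ξ) be the determinant of the 2×2 matrix [a_{αβ}(ξ)] and let [a^{αβ}(ξ)] denote its inverse matrix. Let ρ_u > 0 and ρ_θ > 0 be constants and let B₁, …, B_m : S → ℝ be nonnegative measurable functions such that the functions B_i B_j √a and B_i B_j a^{αβ} √a are integrable over S for all i, j, α, β, and ∫_S B_i² √a dξ > 0 for every i. Define the matrices (M_u)_{ij} = ∫_S ρ_u B_i B_j √a dξ and (M_θ^{αβ})_{ij} = ∫_S ρ_θ B_i B_j a^{αβ} √a dξ for i, j = 1,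 …, m. Then every row sum of M_u is positive, and for each α ∈ {1,2} and each i, the quantity (L^α)_{ii} = Σ_{β=1}^{2} Σ_{j=1}^{m} (M_θ^{αβ})_{ij} is positive; consequently the row-sum lumped mass matrix 𝓛(M) = diag(𝓛(M_u), 𝓛(M_u), 𝓛(M_u), L¹, L²), where L^α is the diagonal matrix with entries (L^α)_{ii}, is symmetric positive definite. -/
open MeasureTheory Matrix
open scoped RealInnerProductSpace

noncomputable section

/-- Surface metric (Gram) matrix `[a_{αβ}(ξ)] = [⟨a_α(ξ), a_β(ξ)⟩]`. -/
def surfMetric (a₁ a₂ : EuclideanSpace ℝ (Fin 2) → EuclideanSpace ℝ (Fin 3))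
    (ξ : EuclideanSpace ℝ (Fin 2)) : Matrix (Fin 2) (Fin 2) ℝ :=
  Matrix.of fun α β => ⟪![a₁ ξ, a₂ ξ] α, ![a₁ ξ, a₂ ξ] β⟫

/-- Surface area element `√a(ξ)` where `a = det [a_{αβ}]`. -/
def surfVol (a₁ a₂ : EuclideanSpace ℝ (Fin 2) → EuclideanSpace ℝ (Fin 3))
    (ξ : EuclideanSpace ℝ (Fin 2)) : ℝ :=
  Real.sqrt (surfMetric a₁ a₂ ξ).det

/-- Contravariant metric `[a^{αβ}(ξ)] = [a_{αβ}(ξ)]⁻¹`. -/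
def contraMetric (a₁ a₂ : EuclideanSpace ℝ (Fin 2) → EuclideanSpace ℝ (Fin 3))
    (ξ : EuclideanSpace ℝ (Fin 2)) : Matrix (Fin 2) (Fin 2) ℝ :=
  (surfMetric a₁ a₂ ξ)⁻¹

/-- Displacement mass matrix `(M_u)_{ij} = ∫_S ρ_u B_i B_j √a dξ`. -/
def massU {m : ℕ} (S : Set (EuclideanSpace ℝ (Fin 2))) (ρu : ℝ)
    (a₁ a₂ : EuclideanSpace ℝ (Fin 2) → EuclideanSpace ℝ (Fin 3))
    (B : Fin m → EuclideanSpace ℝ (Fin 2) → ℝ) : Matrix (Fin m) (Fin m) ℝ :=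
  Matrix.of fun i j => ∫ ξ in S, ρu * B i ξ * B j ξ * surfVol a₁ a₂ ξ

/-- Rotational mass blocks `(M_θ^{αβ})_{ij} = ∫_S ρ_θ B_i B_j a^{αβ} √a dξ`. -/
def massTheta {m : ℕ} (S : Set (EuclideanSpace ℝ (Fin 2))) (ρθ : ℝ)
    (a₁ a₂ : EuclideanSpace ℝ (Fin 2) → EuclideanSpace ℝ (Fin 3))
    (B : Fin m → EuclideanSpace ℝ (Fin 2) → ℝ) (α β : Fin 2) :
    Matrix (Fin m) (Fin m) ℝ :=
  Matrix.of fun i j =>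
    ∫ ξ in S, ρθ * B i ξ * B j ξ * contraMetric a₁ a₂ ξ α β * surfVol a₁ a₂ ξ

/-- Row-sum lumped mass matrix `𝓛(M) = diag(𝓛(M_u), 𝓛(M_u), 𝓛(M_u), L¹, L²)` with
`(L^α)_{ii} = Σ_β Σ_j (M_θ^{αβ})_{ij}`. -/
def lumpedMass {m : ℕ} (S : Set (EuclideanSpace ℝ (Fin 2))) (ρu ρθ : ℝ)
    (a₁ a₂ : EuclideanSpace ℝ (Fin 2) → EuclideanSpace ℝ (Fin 3))
    (B : Fin m → EuclideanSpace ℝ (Fin 2) → ℝ) :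
    Matrix (Fin 5 × Fin m) (Fin 5 × Fin m) ℝ :=
  Matrix.diagonal fun p =>
    if (p.1 : ℕ) < 3 then ∑ j, massU S ρu a₁ a₂ B p.2 j
    else ∑ β : Fin 2, ∑ j,
      massTheta S ρθ a₁ a₂ B (if (p.1 : ℕ) = 3 then 0 else 1) β p.2 j

/-- The row sums of the inverse of a symmetric `2 × 2` matrix with positive determinant are
positive as soon as both diagonal entries exceed the off-diagonal one. -/
theorem Matrix.inv_fin_two_row_sum_pos {p q c : ℝ} (hdet : 0 < p * q - c * c)
    (hp : c < p) (hq : c < q) (α : Fin 2) :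
    0 < ∑ β : Fin 2, (!![p, c; c, q]⁻¹ : Matrix (Fin 2) (Fin 2) ℝ) α β := by
  rw [Matrix.inv_def, Matrix.det_fin_two_of, Ring.inverse_eq_inv', Matrix.adjugate_fin_two_of]
  have h := inv_pos.2 hdet
  fin_cases α
  · simp [Fin.sum_univ_two]
    nlinarith
  · simp [Fin.sum_univ_two]
    nlinarith

theorem surfMetric_eq (a₁ a₂ : EuclideanSpace ℝ (Fin 2) → EuclideanSpace ℝ (Fin 3))
    (ξ : EuclideanSpace ℝ (Fin 2)) :
    surfMetric a₁ a₂ ξ =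
      !![‖a₁ ξ‖ ^ 2, ⟪a₁ ξ, a₂ ξ⟫; ⟪a₁ ξ, a₂ ξ⟫, ‖a₂ ξ‖ ^ 2] := by
  ext α β
  fin_cases α <;> fin_cases β <;> simp [surfMetric, real_inner_comm]

/-- Strict Cauchy–Schwarz for linearly independent vectors. -/
theorem gram_pos_of_linearIndependent {E : Type*} [NormedAddCommGroup E] [InnerProductSpace ℝ E]
    {x y : E} (h : LinearIndependent ℝ ![x, y]) :
    0 < ‖x‖ ^ 2 * ‖y‖ ^ 2 - ⟪x, y⟫ * ⟪x, y⟫ := by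
  have hx : x ≠ 0 := h.ne_zero 0
  have hlt : |⟪x, y⟫| < ‖x‖ * ‖y‖ := by
    refine lt_of_le_of_ne (abs_real_inner_le_norm x y) fun heq => ?_
    have hor : x = 0 ∨ ∃ r : ℝ, y = r • x := ((norm_inner_eq_norm_tfae ℝ x y).out 0 2).1 heq
    obtain ⟨r, hr⟩ := hor.resolve_left hx
    have := LinearIndependent.pair_iff.1 h r (-1) (by simp [hr])
    simp at this
  have := sq_lt_sq' (by linarith [abs_nonneg ⟪x, y⟫]) hlt
  rw [sq_abs] at this
  nlinarith

/-- The angle condition bounds the inner product by both squared norms. -/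
theorem inner_lt_sq_norm_of_angle {E : Type*} [NormedAddCommGroup E] [InnerProductSpace ℝ E]
    {x y : E} (hx : x ≠ 0) (hy : y ≠ 0)
    (h : min ‖x‖ ‖y‖ / max ‖x‖ ‖y‖ > ⟪x, y⟫ / (‖x‖ * ‖y‖)) :
    ⟪x, y⟫ < ‖x‖ ^ 2 ∧ ⟪x, y⟫ < ‖y‖ ^ 2 := by
  have hx' := norm_pos_iff.2 hx
  have hy' := norm_pos_iff.2 hy
  have hmax : 0 < max ‖x‖ ‖y‖ := lt_max_of_lt_left hx'
  have hmin : 0 < min ‖x‖ ‖y‖ := lt_min hx' hy'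
  have key : ⟪x, y⟫ < min ‖x‖ ‖y‖ ^ 2 := by
    rw [gt_iff_lt, ← min_mul_max, div_lt_div_iff₀ (mul_pos hmin hmax) hmax] at h
    nlinarith
  exact ⟨key.trans_le (pow_le_pow_left₀ hmin.le (min_le_left _ _) 2),
    key.trans_le (pow_le_pow_left₀ hmin.le (min_le_right _ _) 2)⟩

theorem surfVol_pos {a₁ a₂ : EuclideanSpace ℝ (Fin 2) → EuclideanSpace ℝ (Fin 3)}
    {ξ : EuclideanSpace ℝ (Fin 2)} (h : LinearIndependent ℝ ![a₁ ξ, a₂ ξ]) :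
    0 < surfVol a₁ a₂ ξ := by
  rw [surfVol, surfMetric_eq, Matrix.det_fin_two_of]
  exact Real.sqrt_pos.2 (gram_pos_of_linearIndependent h)

theorem contraMetric_row_sum_pos {a₁ a₂ : EuclideanSpace ℝ (Fin 2) → EuclideanSpace ℝ (Fin 3)}
    {ξ : EuclideanSpace ℝ (Fin 2)} (h : LinearIndependent ℝ ![a₁ ξ, a₂ ξ])
    (hangle : min ‖a₁ ξ‖ ‖a₂ ξ‖ / max ‖a₁ ξ‖ ‖a₂ ξ‖ > ⟪a₁ ξ, a₂ ξ⟫ / (‖a₁ ξ‖ * ‖a₂ ξ‖))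
    (α : Fin 2) : 0 < ∑ β : Fin 2, contraMetric a₁ a₂ ξ α β := by
  obtain ⟨h₁, h₂⟩ := inner_lt_sq_norm_of_angle (h.ne_zero 0) (h.ne_zero 1) hangle
  rw [contraMetric, surfMetric_eq]
  exact Matrix.inv_fin_two_row_sum_pos (gram_pos_of_linearIndependent h) h₁ h₂ α

/-- If `f` has positive integral and `g` is a.e. nonnegative, integrable, and a.e. nonzero
wherever `f` is, then `g` has positive integral. -/
theorem MeasureTheory.integral_pos_of_integral_pos {X : Type*} [MeasurableSpace X]
    {μ : Measure X} {f g : X → ℝ} (hf : 0 < ∫ x, f x ∂μ) (hg : Integrable g μ)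
    (hg₀ : ∀ᵐ x ∂μ, 0 ≤ g x) (hfg : ∀ᵐ x ∂μ, g x = 0 → f x = 0) :
    0 < ∫ x, g x ∂μ := by
  refine lt_of_le_of_ne (integral_nonneg_of_ae hg₀) fun h => hf.ne' ?_
  have hz := (integral_eq_zero_iff_of_nonneg_ae hg₀ hg).1 h.symm
  refine integral_eq_zero_of_ae ?_
  filter_upwards [hz, hfg] with x hx hx'
  exact hx' hx

/-- Row sums of a weighted mass matrix with a.e. positive weight are positive. -/
theorem weighted_mass_row_sum_pos {X ι : Type*} [MeasurableSpace X] [Fintype ι] {μ : Measure X}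
    {B : ι → X → ℝ} {v w : X → ℝ} (hB : ∀ i x, 0 ≤ B i x) (hw : ∀ᵐ x ∂μ, 0 < w x)
    (hint : ∀ i j, Integrable (fun x => B i x * B j x * w x) μ)
    (hpos : ∀ i, 0 < ∫ x, B i x ^ 2 * v x ∂μ) (i : ι) :
    0 < ∑ j, ∫ x, B i x * B j x * w x ∂μ := by
  have hnn : ∀ j, ∀ᵐ x ∂μ, 0 ≤ B i x * B j x * w x := fun j => by
    filter_upwards [hw] with x hx
    exact mul_nonneg (mul_nonneg (hB i x) (hB j x)) hx.le
  refine Finset.sum_pos' (fun j _ => integral_nonneg_of_ae (hnn j)) ⟨i, Finset.mem_univ i, ?_⟩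
  refine integral_pos_of_integral_pos (hpos i) (hint i i) (hnn i) ?_
  filter_upwards [hw] with x hx h
  have hz : B i x = 0 := by simpa [hx.ne'] using h
  simp [hz]

/-- Lemma 4.1: under the a.e. linear independence and angle condition on the
covariant basis vectors, positive densities, nonnegative basis functions with integrable
products and positive squared integrals, every row sum of `M_u` is positive, every lumped
rotational diagonal entry `(L^α)_{ii}` is positive, and the row-sum lumped mass matrix
`𝓛(M)` is symmetric positive definite. -/
theorem lumped_mass_posDef (m : ℕ)
    (S : Set (EuclideanSpace ℝ (Fin 2))) (hS : MeasurableSet S)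
    (a₁ a₂ : EuclideanSpace ℝ (Fin 2) → EuclideanSpace ℝ (Fin 3))
    (ha₁ : Measurable a₁) (ha₂ : Measurable a₂)
    (hae : ∀ᵐ ξ ∂(volume.restrict S),
      LinearIndependent ℝ ![a₁ ξ, a₂ ξ] ∧
      min ‖a₁ ξ‖ ‖a₂ ξ‖ / max ‖a₁ ξ‖ ‖a₂ ξ‖ > ⟪a₁ ξ, a₂ ξ⟫ / (‖a₁ ξ‖ * ‖a₂ ξ‖))
    (ρu ρθ : ℝ) (hρu : 0 < ρu) (hρθ : 0 < ρθ)
    (B : Fin m → EuclideanSpace ℝ (Fin 2) → ℝ)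
    (hBmeas : ∀ i, Measurable (B i)) (hBnonneg : ∀ i ξ, 0 ≤ B i ξ)
    (hint1 : ∀ i j : Fin m,
      IntegrableOn (fun ξ => B i ξ * B j ξ * surfVol a₁ a₂ ξ) S)
    (hint2 : ∀ (i j : Fin m) (α β : Fin 2),
      IntegrableOn (fun ξ => B i ξ * B j ξ * contraMetric a₁ a₂ ξ α β * surfVol a₁ a₂ ξ) S)
    (hBpos : ∀ i, 0 < ∫ ξ in S, B i ξ ^ 2 * surfVol a₁ a₂ ξ) :
    (∀ i, 0 < ∑ j, massU S ρu a₁ a₂ B i j) ∧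
    (∀ (α : Fin 2) (i : Fin m), 0 < ∑ β : Fin 2, ∑ j, massTheta S ρθ a₁ a₂ B α β i j) ∧
    (lumpedMass S ρu ρθ a₁ a₂ B).IsSymm ∧ (lumpedMass S ρu ρθ a₁ a₂ B).PosDef := by
  have hU : ∀ i, 0 < ∑ j, massU S ρu a₁ a₂ B i j := fun i => by
    have h := weighted_mass_row_sum_pos hBnonneg
      (hae.mono fun ξ hξ => surfVol_pos hξ.1) hint1 hBpos i
    simp only [massU, Matrix.of_apply, mul_assoc, integral_const_mul, ← Finset.mul_sum] at h ⊢
    exact mul_pos hρu h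
  have hΘ : ∀ (α : Fin 2) (i : Fin m),
      0 < ∑ β : Fin 2, ∑ j, massTheta S ρθ a₁ a₂ B α β i j := fun α i => by
    have hsum : ∀ (i j : Fin m) (ξ : EuclideanSpace ℝ (Fin 2)),
        B i ξ * B j ξ * ((∑ β, contraMetric a₁ a₂ ξ α β) * surfVol a₁ a₂ ξ) =
          ∑ β, B i ξ * B j ξ * contraMetric a₁ a₂ ξ α β * surfVol a₁ a₂ ξ := fun i j ξ => by
      simp only [Finset.sum_mul, Finset.mul_sum, mul_assoc]
    have h := weighted_mass_row_sum_pos (μ := volume.restrict S)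
      (w := fun ξ => (∑ β, contraMetric a₁ a₂ ξ α β) * surfVol a₁ a₂ ξ) hBnonneg
      (hae.mono fun ξ hξ => mul_pos (contraMetric_row_sum_pos hξ.1 hξ.2 α) (surfVol_pos hξ.1))
      (fun i j => by
        simp only [hsum]
        exact integrable_finsetSum _ fun β _ => hint2 i j α β)
      hBpos i
    simp only [hsum] at h
    simp_rw [integral_finsetSum Finset.univ fun β _ => hint2 i _ α β] at h
    rw [Finset.sum_comm] at h
    simp only [massTheta, Matrix.of_apply, mul_assoc, integral_const_mul, ← Finset.mul_sum] at h ⊢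
    exact mul_pos hρθ h
  refine ⟨hU, hΘ, Matrix.isSymm_diagonal _, Matrix.PosDef.diagonal fun p => ?_⟩
  split_ifs
  exacts [hU p.2, hΘ _ p.2, hΘ _ p.2]

end
end

section
/- Let a₁, a₂ ∈ ℝ³ be linearly independent vectors satisfying the angle condition min(‖a₁‖, ‖a₂‖)/max(‖a₁‖, ‖a₂‖) > ⟨a₁, a₂⟩/(‖a₁‖ ‖a₂‖). Let A be the 2×2 Gram matrix with entries A_{αβ} = ⟨a_α, a_β⟩. Then A is invertible and both row sums of its inverse are positive: (A⁻¹)₁₁ + (A⁻¹)₁₂ > 0 and (A⁻¹)₂₁ + (A⁻¹)₂₂ > 0. -/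
open scoped RealInnerProductSpace

/-- If the cosine of the angle between `x` and `y` is less than the ratio of the smaller norm to the
larger one, then `⟪x, y⟫` is less than the square of the smaller norm. -/
theorem real_inner_lt_min_norm_sq {E : Type*} [NormedAddCommGroup E] [InnerProductSpace ℝ E]
    {x y : E} (hx : x ≠ 0) (hy : y ≠ 0)
    (h : ⟪x, y⟫ / (‖x‖ * ‖y‖) < min ‖x‖ ‖y‖ / max ‖x‖ ‖y‖) :
    ⟪x, y⟫ < min ‖x‖ ‖y‖ ^ 2 := by
  have hmin : 0 < min ‖x‖ ‖y‖ := lt_min (norm_pos_iff.2 hx) (norm_pos_iff.2 hy)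
  have hmax : 0 < max ‖x‖ ‖y‖ := hmin.trans_le min_le_max
  rw [← min_mul_max ‖x‖ ‖y‖, div_lt_iff₀ (mul_pos hmin hmax)] at h
  calc ⟪x, y⟫ < min ‖x‖ ‖y‖ / max ‖x‖ ‖y‖ * (min ‖x‖ ‖y‖ * max ‖x‖ ‖y‖) := h
    _ = min ‖x‖ ‖y‖ ^ 2 := by field_simp

/-- For linearly independent `a₁, a₂ ∈ ℝ³` satisfying the angle condition,
the Gram matrix `A` with `A_{αβ} = ⟨a_α, a_β⟩` is invertible and both row sums of its
inverse are positive. -/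
theorem gram_inverse_row_sums_pos
    (a₁ a₂ : EuclideanSpace ℝ (Fin 3))
    (hli : LinearIndependent ℝ ![a₁, a₂])
    (hangle : min ‖a₁‖ ‖a₂‖ / max ‖a₁‖ ‖a₂‖ > ⟪a₁, a₂⟫ / (‖a₁‖ * ‖a₂‖)) :
    IsUnit (Matrix.of fun α β : Fin 2 => ⟪![a₁, a₂] α, ![a₁, a₂] β⟫) ∧
    0 < (Matrix.of fun α β : Fin 2 => ⟪![a₁, a₂] α, ![a₁, a₂] β⟫)⁻¹ 0 0 +
        (Matrix.of fun α β : Fin 2 => ⟪![a₁, a₂] α, ![a₁, a₂] β⟫)⁻¹ 0 1 ∧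
    0 < (Matrix.of fun α β : Fin 2 => ⟪![a₁, a₂] α, ![a₁, a₂] β⟫)⁻¹ 1 0 +
        (Matrix.of fun α β : Fin 2 => ⟪![a₁, a₂] α, ![a₁, a₂] β⟫)⁻¹ 1 1 := by
  have h₁ : a₁ ≠ 0 := by simpa using hli.ne_zero 0
  have h₂ : a₂ ≠ 0 := by simpa using hli.ne_zero 1
  have hlt := real_inner_lt_min_norm_sq h₁ h₂ hangle
  have hlt₁ : ⟪a₁, a₂⟫ < ⟪a₁, a₁⟫ := by
    rw [real_inner_self_eq_norm_sq]
    exact hlt.trans_le (by gcongr; exact min_le_left _ _)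
  have hlt₂ : ⟪a₁, a₂⟫ < ⟪a₂, a₂⟫ := by
    rw [real_inner_self_eq_norm_sq]
    exact hlt.trans_le (by gcongr; exact min_le_right _ _)
  have hpos := Matrix.posDef_gram_of_linearIndependent (𝕜 := ℝ) hli
  have hdet := inv_pos.2 hpos.det_pos
  rw [← Matrix.gram]
  refine ⟨hpos.isUnit, ?_, ?_⟩
  · have := mul_pos hdet (sub_pos.2 hlt₂)
    simpa [Matrix.inv_def, Matrix.adjugate_fin_two, Matrix.gram_apply, ← sub_eq_add_neg,
      ← mul_sub] using this
  · have := mul_pos hdet (sub_pos.2 hlt₁)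
    simpa [Matrix.inv_def, Matrix.adjugate_fin_two, Matrix.gram_apply, real_inner_comm a₁ a₂,
      neg_add_eq_sub, ← mul_sub] using this
end

section
/- Let λ, μ ∈ ℝ with λ + 2μ ≠ 0. Let b be a symmetric 3×3 real matrix with b_{13} = b_{31} = b_{23} = b_{32} = 0 and b_{33} = 1 (b^{ij} := b_{ij} plays the role of the extended contravariant metric, with b^{αβ} for α, β ∈ {1,2} the surface contravariant metric a^{αβ}). Define the fourth-order tensor A^{ijkl} = λ b^{ij} b^{kl} + μ (b^{ik} b^{jl} + b^{il} b^{jk}) for i, j, k, l ∈ {1,2,3}. Let ε be a symmetric 3×3 real matrix whose (3,3) entry satisfies the plane-stress condition ε_{33} = −λ (Σ_{γ,δ=1}^{2} b^{γδ} ε_{γδ})/(λ + 2μ). Then Σ_{i,j,k,l=1}^{3} A^{ijkl} ε_{ij} ε_{kl} = Σ_{α,β,γ,δ=1}^{2} E^{αβγδ} ε_{αβ} ε_{γδ} + Σ_{α,β=1}^{2} μ b^{αβ} γ_α γ_β, where E^{αβγδ} = (2λμ/(λ + 2μ)) b^{αβ} b^{γδ} + μ (b^{αγ} b^{βδ} +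 b^{αδ} b^{βγ}) is the shell elasticity tensor and γ_α = 2ε_{3α}. -/
/-- Reduction of the 3D isotropic constitutive relation to the 2D shell
constitutive relation under the plane-stress condition
`ε₃₃ = −λ (Σ_{γδ} b^{γδ} ε_{γδ})/(λ + 2μ)`:
`Σ A^{ijkl} ε_{ij} ε_{kl} = Σ E^{αβγδ} ε_{αβ} ε_{γδ} + Σ μ b^{αβ} γ_α γ_β`
with `E^{αβγδ} = (2λμ/(λ+2μ)) b^{αβ}b^{γδ} + μ(b^{αγ}b^{βδ} + b^{αδ}b^{βγ})` and
`γ_α = 2ε_{3α}`. -/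
theorem shell_constitutive_reduction
    (lam mu : ℝ) (hlm : lam + 2 * mu ≠ 0)
    (b : Matrix (Fin 3) (Fin 3) ℝ) (hb : b.IsSymm)
    (hb02 : b 0 2 = 0) (hb20 : b 2 0 = 0) (hb12 : b 1 2 = 0) (hb21 : b 2 1 = 0)
    (hb22 : b 2 2 = 1)
    (ε : Matrix (Fin 3) (Fin 3) ℝ) (hε : ε.IsSymm)
    (hps : ε 2 2 = -lam * (∑ γ : Fin 2, ∑ δ : Fin 2,
        b γ.castSucc δ.castSucc * ε γ.castSucc δ.castSucc) / (lam + 2 * mu)) :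
    ∑ i : Fin 3, ∑ j : Fin 3, ∑ k : Fin 3, ∑ l : Fin 3,
        (lam * b i j * b k l + mu * (b i k * b j l + b i l * b j k)) * ε i j * ε k l =
      (∑ α : Fin 2, ∑ β : Fin 2, ∑ γ : Fin 2, ∑ δ : Fin 2,
          (2 * lam * mu / (lam + 2 * mu) * b α.castSucc β.castSucc * b γ.castSucc δ.castSucc +
            mu * (b α.castSucc γ.castSucc * b β.castSucc δ.castSucc +
              b α.castSucc δ.castSucc * b β.castSucc γ.castSucc)) *
            ε α.castSucc β.castSucc * ε γ.castSucc δ.castSucc) +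
      ∑ α : Fin 2, ∑ β : Fin 2,
        mu * b α.castSucc β.castSucc * (2 * ε 2 α.castSucc) * (2 * ε 2 β.castSucc) := by
  set T := ∑ γ : Fin 2, ∑ δ : Fin 2, b γ.castSucc δ.castSucc * ε γ.castSucc δ.castSucc with hT
  have hstress : (lam + 2 * mu) * ε 2 2 = -lam * T := by
    rw [hps]
    field_simp
  have hmodulus : 2 * lam * mu / (lam + 2 * mu) * T = lam * (T + ε 2 2) := by
    rw [hps]
    field_simp
    ring
  generalize 2 * lam * mu / (lam + 2 * mu) = q at hmodulus ⊢
  have hb10 : b 1 0 = b 0 1 := hb.apply 0 1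
  have hε10 : ε 1 0 = ε 0 1 := hε.apply 0 1
  have hε20 : ε 2 0 = ε 0 2 := hε.apply 0 2
  have hε21 : ε 2 1 = ε 1 2 := hε.apply 1 2
  clear_value T
  clear hps
  simp only [Fin.sum_univ_three, Fin.sum_univ_two, Fin.castSucc_zero, Fin.castSucc_one,
    hb02, hb20, hb12, hb21, hb22, hb10, hε10, hε20, hε21] at hT ⊢
  subst hT
  linear_combination
    ε 2 2 * hstress - (b 0 0 * ε 0 0 + b 0 1 * ε 0 1 + (b 0 1 * ε 0 1 + b 1 1 * ε 1 1)) * hmodulus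
end

section
/- Let (S, μ) be a measure space, m ∈ ℕ, and B₁, …, B_m : S → ℝ measurable functions that are linearly independent modulo μ-null sets (i.e. if a linear combination Σᵢ cᵢ Bᵢ vanishes μ-almost everywhere then all cᵢ = 0). Let W : S → ℝ^{2×2} be a measurable matrix-valued function such that W(ξ) is symmetric positive definite for μ-almost every ξ, and such that B_i B_j W_{αβ} is μ-integrable for all i, j ∈ {1,…,m} and α, β ∈ {1,2}. Then the 2m×2m block matrix M with entries M_{(α,i),(β,j)} = ∫_S B_i B_j W_{αβ} dμ is symmetric positive definite. -/
open MeasureTheory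

/-- The quadratic form of the matrix `((α, i), (β, j)) ↦ b i * b j * A α β` at `x` is the quadratic
form of `A` at the contracted vector `α ↦ ∑ i, x (α, i) * b i`. -/
theorem sum_sum_mul_eq_dotProduct_mulVec {n κ : Type*} [Fintype n] [Fintype κ]
    (x : n × κ → ℝ) (b : κ → ℝ) (A : Matrix n n ℝ) :
    ∑ p, ∑ q, x p * (b p.2 * b q.2 * A p.1 q.1) * x q =
      (fun α => ∑ i, x (α, i) * b i) ⬝ᵥ A.mulVec (fun α => ∑ i, x (α, i) * b i) := by
  simp only [dotProduct, Matrix.mulVec, Fintype.sum_prod_type]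
  refine Finset.sum_congr rfl fun α _ => ?_
  rw [Finset.sum_mul]
  refine Finset.sum_congr rfl fun i _ => ?_
  rw [Finset.mul_sum]
  refine Finset.sum_congr rfl fun β _ => ?_
  rw [Finset.mul_sum, Finset.mul_sum]
  exact Finset.sum_congr rfl fun j _ => by ring

/-- A finite quadratic form with integrated coefficients is the integral of the quadratic form. -/
theorem sum_sum_mul_integral_eq {S ι : Type*} [MeasurableSpace S] {μ : Measure S} [Fintype ι]
    {F : ι → ι → S → ℝ} (hF : ∀ p q, Integrable (F p q) μ) (x : ι → ℝ) :
    ∑ p, ∑ q, x p * (∫ ξ, F p q ξ ∂μ) * x q = ∫ ξ, ∑ p, ∑ q, x p * F p q ξ * x q ∂μ := by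
  have h : ∀ p q, Integrable (fun ξ => x p * F p q ξ * x q) μ := fun p q =>
    ((hF p q).const_mul (x p)).mul_const (x q)
  rw [integral_finsetSum _ fun p _ => integrable_finsetSum _ fun q _ => h p q]
  refine Finset.sum_congr rfl fun p _ => ?_
  rw [integral_finsetSum _ fun q _ => h p q]
  simp only [integral_mul_const, integral_const_mul]

/-- For measurable `B₁, …, B_m` linearly independent modulo `μ`-null sets
and a measurable `W : S → ℝ^{2×2}` which is a.e. symmetric positive definite, with all
products `B_i B_j W_{αβ}` integrable, the `2m×2m` block matrix
`M_{(α,i),(β,j)} = ∫ B_i B_j W_{αβ} dμ` is symmetric positive definite. -/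
theorem block_mass_matrix_posDef
    {S : Type*} [MeasurableSpace S] (μ : Measure S) (m : ℕ)
    (B : Fin m → S → ℝ) (hBmeas : ∀ i, Measurable (B i))
    (hBli : ∀ c : Fin m → ℝ, (∀ᵐ ξ ∂μ, ∑ i, c i * B i ξ = 0) → ∀ i, c i = 0)
    (W : S → Matrix (Fin 2) (Fin 2) ℝ)
    (hWmeas : ∀ α β : Fin 2, Measurable fun ξ => W ξ α β)
    (hWpd : ∀ᵐ ξ ∂μ, (W ξ).PosDef)
    (hint : ∀ (i j : Fin m) (α β : Fin 2),
      Integrable (fun ξ => B i ξ * B j ξ * W ξ α β) μ) :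
    (Matrix.of fun p q : Fin 2 × Fin m =>
        ∫ ξ, B p.2 ξ * B q.2 ξ * W ξ p.1 q.1 ∂μ).IsSymm ∧
    (Matrix.of fun p q : Fin 2 × Fin m =>
        ∫ ξ, B p.2 ξ * B q.2 ξ * W ξ p.1 q.1 ∂μ).PosDef := by
  have hsymm : (Matrix.of fun p q : Fin 2 × Fin m =>
      ∫ ξ, B p.2 ξ * B q.2 ξ * W ξ p.1 q.1 ∂μ).IsSymm := by
    refine Matrix.IsSymm.ext fun p q => integral_congr_ae ?_
    filter_upwards [hWpd] with ξ hξ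
    have hW : W ξ q.1 p.1 = W ξ p.1 q.1 := by simpa using hξ.isHermitian.apply p.1 q.1
    rw [hW, mul_comm (B q.2 ξ)]
  refine ⟨hsymm, Matrix.PosDef.of_dotProduct_mulVec_pos
    (Matrix.conjTranspose_eq_transpose_of_trivial _ |>.trans hsymm) fun x hx => ?_⟩
  set y : S → Fin 2 → ℝ := fun ξ α => ∑ i, x (α, i) * B i ξ
  have hquad : ∀ ξ, ∑ p, ∑ q, x p * (B p.2 ξ * B q.2 ξ * W ξ p.1 q.1) * x q =
      y ξ ⬝ᵥ (W ξ).mulVec (y ξ) := fun ξ =>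
    sum_sum_mul_eq_dotProduct_mulVec x (fun i => B i ξ) (W ξ)
  have hform : star x ⬝ᵥ (Matrix.of fun p q : Fin 2 × Fin m =>
      ∫ ξ, B p.2 ξ * B q.2 ξ * W ξ p.1 q.1 ∂μ).mulVec x =
      ∫ ξ, y ξ ⬝ᵥ (W ξ).mulVec (y ξ) ∂μ := by
    simp_rw [← hquad]
    rw [← sum_sum_mul_integral_eq
      (F := fun (p q : Fin 2 × Fin m) ξ => B p.2 ξ * B q.2 ξ * W ξ p.1 q.1)
      (fun p q => hint p.2 q.2 p.1 q.1)]
    simp only [dotProduct, Matrix.mulVec, Matrix.of_apply, star_trivial, Finset.mul_sum, mul_assoc]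
  have hint_form : Integrable (fun ξ => y ξ ⬝ᵥ (W ξ).mulVec (y ξ)) μ := by
    simp_rw [← hquad]
    exact integrable_finsetSum _ fun p _ => integrable_finsetSum _ fun q _ =>
      ((hint p.2 q.2 p.1 q.1).const_mul (x p)).mul_const (x q)
  have hnonneg : 0 ≤ᵐ[μ] fun ξ => y ξ ⬝ᵥ (W ξ).mulVec (y ξ) := by
    filter_upwards [hWpd] with ξ hξ
    simpa using hξ.posSemidef.dotProduct_mulVec_nonneg (y ξ)
  rw [hform]
  refine (integral_nonneg_of_ae hnonneg).lt_of_ne' fun hzero => hx ?_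
  rw [integral_eq_zero_iff_of_nonneg_ae hnonneg hint_form] at hzero
  have hy_zero : ∀ᵐ ξ ∂μ, y ξ = 0 := by
    filter_upwards [hWpd, hzero] with ξ hξ h0
    by_contra hne
    exact (hξ.dotProduct_mulVec_pos hne).ne' (by simpa using h0)
  funext ⟨α, i⟩
  refine hBli (fun j => x (α, j)) ?_ i
  filter_upwards [hy_zero] with ξ hξ using congrFun hξ α
end
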